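/- Let q be a prime power and let n, k₁, k₂, t be positive integers with n ≥ k₁ + k₂ − t + 1 and k₁ ≥ t, k₂ ≥ t. Suppose F ⊆ M(k₁,n) and G ⊆ M(k₂,n) are nonempty cross t-intersecting families. Then |F| ≤ q^{τ_t(F)−t} · [τ_t(F) t]_q · [k₂−t+1 1]_q^{τ_t(G)−t} · [n−τ_t(G) k₁−τ_t(G)]_q. -/

import Mathlib

open Module Set

/-- Gaussian binomial coefficient `[n k]_q`, as a rational number, via the
product formula `∏_{0 ≤ i < k} (q^{n-i} - 1)/(q^{k-i} - 1)`. -/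
noncomputable def gaussQ (q n k : ℕ) : ℚ :=
  ∏ i ∈ Finset.range k, ((q : ℚ) ^ (n - i) - 1) / ((q : ℚ) ^ (k - i) - 1)

/-- `A` is a `k`-flat of the affine space `AG(n, q)` (with `q = |𝔽|`):
a coset `x + P` of a `k`-dimensional linear subspace `P` of `𝔽^n`. -/
def IsFlat (𝔽 : Type) [Field 𝔽] {n : ℕ} (k : ℕ) (A : Set (Fin n → 𝔽)) : Prop :=
  ∃ (P : Submodule 𝔽 (Fin n → 𝔽)) (x : Fin n → 𝔽),
    Module.finrank 𝔽 ↥P = k ∧ A = {v | v - x ∈ P}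

/-- `A` is a flat (in particular nonempty) of dimension at least `t`. -/
def DimGe (𝔽 : Type) [Field 𝔽] {n : ℕ} (t : ℕ) (A : Set (Fin n → 𝔽)) : Prop :=
  ∃ j, t ≤ j ∧ IsFlat 𝔽 j A

/-- Two families of flats are cross `t`-intersecting. -/
def CrossT (𝔽 : Type) [Field 𝔽] {n : ℕ} (t : ℕ)
    (F1 F2 : Set (Set (Fin n → 𝔽))) : Prop :=
  ∀ A ∈ F1, ∀ B ∈ F2, DimGe 𝔽 t (A ∩ B)

/-- A pair of families is trivial: some `t`-flat is contained in every member. -/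
def TrivialPair (𝔽 : Type) [Field 𝔽] {n : ℕ} (t : ℕ)
    (F1 F2 : Set (Set (Fin n → 𝔽))) : Prop :=
  ∃ T : Set (Fin n → 𝔽), IsFlat 𝔽 t T ∧ (∀ A ∈ F1, T ⊆ A) ∧ (∀ B ∈ F2, T ⊆ B)

/-- `T` is a `t`-cover of the family `F`: `dim (T ∩ A) ≥ t` for all `A ∈ F`. -/
def IsTCover (𝔽 : Type) [Field 𝔽] {n : ℕ} (t : ℕ) (T : Set (Fin n → 𝔽))
    (F : Set (Set (Fin n → 𝔽))) : Prop :=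
  ∀ A ∈ F, DimGe 𝔽 t (T ∩ A)

/-- `τ_t(F)`: the minimum dimension of a `t`-cover of `F`. -/
noncomputable def tauT (𝔽 : Type) [Field 𝔽] {n : ℕ} (t : ℕ)
    (F : Set (Set (Fin n → 𝔽))) : ℕ :=
  sInf {x | ∃ T : Set (Fin n → 𝔽), IsFlat 𝔽 x T ∧ IsTCover 𝔽 t T F}

/-- `A₁(M, T; k, t) = {F ∈ M(k,n) : T ⊆ F, dim(F ∩ M) ≥ t + 1}`. -/
def A1 (𝔽 : Type) [Field 𝔽] {n : ℕ} (M T : Set (Fin n → 𝔽)) (k t : ℕ) :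
    Set (Set (Fin n → 𝔽)) :=
  {F | IsFlat 𝔽 k F ∧ T ⊆ F ∧ DimGe 𝔽 (t + 1) (F ∩ M)}

/-- `A₂(M, T; k, t) = {F ∈ M(k,n) : T ⊆ F} ∪ {F ∈ M(k,n) : F ⊆ M, dim(F ∩ T) = t - 1}`. -/
def A2 (𝔽 : Type) [Field 𝔽] {n : ℕ} (M T : Set (Fin n → 𝔽)) (k t : ℕ) :
    Set (Set (Fin n → 𝔽)) :=
  {F | IsFlat 𝔽 k F ∧ T ⊆ F} ∪ {F | IsFlat 𝔽 k F ∧ F ⊆ M ∧ IsFlat 𝔽 (t - 1) (F ∩ T)}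

/-- `A₃(S; k) = {F ∈ M(k,n) : S ⊆ F}`. -/
def A3 (𝔽 : Type) [Field 𝔽] {n : ℕ} (S : Set (Fin n → 𝔽)) (k : ℕ) :
    Set (Set (Fin n → 𝔽)) :=
  {F | IsFlat 𝔽 k F ∧ S ⊆ F}

/-- `A₄(S; k, t) = {F ∈ M(k,n) : dim(F ∩ S) ≥ t}`. -/
def A4 (𝔽 : Type) [Field 𝔽] {n : ℕ} (S : Set (Fin n → 𝔽)) (k t : ℕ) :
    Set (Set (Fin n → 𝔽)) :=
  {F | IsFlat 𝔽 k F ∧ DimGe 𝔽 t (F ∩ S)}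

section Cosets

variable {𝔽 : Type} [Field 𝔽] {n : ℕ}

/-- The coset `x + P`. -/
def coset (x : Fin n → 𝔽) (P : Submodule 𝔽 (Fin n → 𝔽)) : Set (Fin n → 𝔽) :=
  {v | v - x ∈ P}

lemma mem_coset {x v : Fin n → 𝔽} {P : Submodule 𝔽 (Fin n → 𝔽)} :
    v ∈ coset x P ↔ v - x ∈ P := Iff.rfl

lemma self_mem_coset (x : Fin n → 𝔽) (P : Submodule 𝔽 (Fin n → 𝔽)) : x ∈ coset x P := by
  simp [mem_coset]

lemma coset_eq_of_mem {x y : Fin n → 𝔽} {P : Submodule 𝔽 (Fin n → 𝔽)} (h : y ∈ coset x P) :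
    coset x P = coset y P := by
  ext v
  rw [mem_coset, mem_coset, show v - x = (v - y) + (y - x) by abel]
  exact P.add_mem_iff_left h

lemma coset_mono {x : Fin n → 𝔽} {P Q : Submodule 𝔽 (Fin n → 𝔽)} (h : P ≤ Q) :
    coset x P ⊆ coset x Q := fun _ hv => h hv

lemma le_of_coset_subset {x : Fin n → 𝔽} {P Q : Submodule 𝔽 (Fin n → 𝔽)}
    (h : coset x P ⊆ coset x Q) : P ≤ Q := by
  intro v hv
  have : v + x ∈ coset x Q := h (by simpa [mem_coset] using hv)
  simpa [mem_coset] using this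

lemma coset_inter {x y z : Fin n → 𝔽} {P Q : Submodule 𝔽 (Fin n → 𝔽)}
    (hx : z ∈ coset x P) (hy : z ∈ coset y Q) :
    coset x P ∩ coset y Q = coset z (P ⊓ Q) := by
  rw [coset_eq_of_mem hx, coset_eq_of_mem hy]
  rfl

lemma isFlat_coset {k : ℕ} (x : Fin n → 𝔽) {P : Submodule 𝔽 (Fin n → 𝔽)}
    (h : finrank 𝔽 P = k) : IsFlat 𝔽 k (coset x P) := ⟨P, x, h, rfl⟩

lemma IsFlat.exists_coset {k : ℕ} {A : Set (Fin n → 𝔽)} (h : IsFlat 𝔽 k A) :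
    ∃ (x : Fin n → 𝔽) (P : Submodule 𝔽 (Fin n → 𝔽)), finrank 𝔽 P = k ∧ A = coset x P := by
  obtain ⟨P, x, hP, rfl⟩ := h
  exact ⟨x, P, hP, rfl⟩

lemma IsFlat.exists_coset_of_mem {k : ℕ} {A : Set (Fin n → 𝔽)} (h : IsFlat 𝔽 k A)
    {x : Fin n → 𝔽} (hx : x ∈ A) : ∃ P : Submodule 𝔽 (Fin n → 𝔽), finrank 𝔽 P = k ∧ A = coset x P := by
  obtain ⟨y, P, hP, rfl⟩ := h.exists_coset
  exact ⟨P, hP, coset_eq_of_mem hx⟩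

lemma DimGe.nonempty {t : ℕ} {A : Set (Fin n → 𝔽)} (h : DimGe 𝔽 t A) : A.Nonempty := by
  obtain ⟨j, -, P, x, -, rfl⟩ := h
  exact ⟨x, self_mem_coset x P⟩

lemma dimGe_coset_iff {t : ℕ} {x : Fin n → 𝔽} {P : Submodule 𝔽 (Fin n → 𝔽)} :
    DimGe 𝔽 t (coset x P) ↔ t ≤ finrank 𝔽 P := by
  constructor
  · rintro ⟨j, hj, hflat⟩
    obtain ⟨Q, rfl, hQ⟩ := hflat.exists_coset_of_mem (self_mem_coset x P)
    rwa [le_antisymm (le_of_coset_subset hQ.subset) (le_of_coset_subset hQ.superset)]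
  · exact fun h => ⟨_, h, isFlat_coset x rfl⟩

end Cosets

section SubspaceCounting

variable {𝔽 V : Type} [Field 𝔽] [Fintype 𝔽] [AddCommGroup V] [Module 𝔽 V] [Finite V]

lemma gaussQ_nonneg {q : ℕ} (hq : 1 ≤ q) (n k : ℕ) : 0 ≤ gaussQ q n k := by
  have hq' : (1 : ℚ) ≤ q := by exact_mod_cast hq
  exact Finset.prod_nonneg fun i _ => div_nonneg
    (sub_nonneg.2 (one_le_pow₀ hq')) (sub_nonneg.2 (one_le_pow₀ hq'))

lemma gaussQ_one_mono {q : ℕ} (hq : 1 < q) {m n : ℕ} (h : m ≤ n) :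
    gaussQ q m 1 ≤ gaussQ q n 1 := by
  have hq' : (1 : ℚ) < q := by exact_mod_cast hq
  simp only [gaussQ, Finset.prod_range_one, Nat.sub_zero, pow_one]
  have := sub_pos.2 hq'
  gcongr
  exact hq'.le

omit [Fintype 𝔽] in
lemma span_range_subtype_eq {k : ℕ} {P : Submodule 𝔽 V} (hP : finrank 𝔽 P = k)
    {s : Fin k → P} (hs : LinearIndependent 𝔽 s) :
    Submodule.span 𝔽 (range fun i => (s i : V)) = P := by
  have h := hs.span_eq_top_of_card_eq_finrank' (by simp [hP])
  have h2 := congrArg (Submodule.map P.subtype) h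
  rwa [Submodule.map_span, Submodule.map_top, Submodule.range_subtype, ← range_comp] at h2

lemma natCard_finrank_eq_mul_le (k : ℕ) (hk : k ≤ finrank 𝔽 V) :
    Nat.card {P : Submodule 𝔽 V // finrank 𝔽 P = k} *
        ∏ i : Fin k, (Fintype.card 𝔽 ^ k - Fintype.card 𝔽 ^ i.val) ≤
      ∏ i : Fin k, (Fintype.card 𝔽 ^ finrank 𝔽 V - Fintype.card 𝔽 ^ i.val) := by
  classical
  let f : (Σ P : {P : Submodule 𝔽 V // finrank 𝔽 P = k},
      {s : Fin k → P.1 // LinearIndependent 𝔽 s}) → {s : Fin k → V // LinearIndependent 𝔽 s} :=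
    fun x => ⟨fun i => x.2.1 i, x.2.2.map' _ x.1.1.ker_subtype⟩
  have hf : Function.Injective f := by
    rintro ⟨⟨P, hP⟩, s, hs⟩ ⟨⟨Q, hQ⟩, r, hr⟩ h
    have h' : (fun i => (s i : V)) = fun i => (r i : V) := congrArg Subtype.val h
    obtain rfl : P = Q := by
      rw [← span_range_subtype_eq hP hs, h', span_range_subtype_eq hQ hr]
    obtain rfl : s = r := funext fun i => Subtype.ext (congrFun h' i)
    rfl
  have h := Nat.card_le_card_of_injective f hf
  have := Fintype.ofFinite {P : Submodule 𝔽 V // finrank 𝔽 P = k}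
  have hcard (P : {P : Submodule 𝔽 V // finrank 𝔽 P = k}) :
      Nat.card {s : Fin k → P.1 // LinearIndependent 𝔽 s} =
        ∏ i : Fin k, (Fintype.card 𝔽 ^ k - Fintype.card 𝔽 ^ i.val) := by
    rw [card_linearIndependent P.2.ge, P.2]
  rw [Nat.card_sigma, Finset.sum_congr rfl fun P _ => hcard P, Finset.sum_const, smul_eq_mul,
    Finset.card_univ, ← Nat.card_eq_fintype_card, card_linearIndependent hk] at h
  exact h

/-- The number of `k`-dimensional subspaces is at most the Gaussian binomial coefficient. -/
theorem natCard_finrank_eq_le_gaussQ (k : ℕ) :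
    (Nat.card {P : Submodule 𝔽 V // finrank 𝔽 P = k} : ℚ) ≤
      gaussQ (Fintype.card 𝔽) (finrank 𝔽 V) k := by
  have hq : 1 < Fintype.card 𝔽 := Fintype.one_lt_card
  rcases lt_or_ge (finrank 𝔽 V) k with hk | hk
  · have : IsEmpty {P : Submodule 𝔽 V // finrank 𝔽 P = k} :=
      ⟨fun P => (P.2 ▸ P.1.finrank_le).not_gt hk⟩
    simpa using gaussQ_nonneg hq.le _ _
  have h := natCard_finrank_eq_mul_le (𝔽 := 𝔽) (V := V) k hk
  set q := Fintype.card 𝔽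
  set m := finrank 𝔽 V
  have hq' : (1 : ℚ) < q := by exact_mod_cast hq
  have key : ∀ d, k ≤ d → ((∏ i : Fin k, (q ^ d - q ^ i.val) : ℕ) : ℚ) =
      (∏ i ∈ Finset.range k, (q : ℚ) ^ i) * ∏ i ∈ Finset.range k, ((q : ℚ) ^ (d - i) - 1) := by
    intro d hd
    rw [Fin.prod_univ_eq_prod_range (fun i => q ^ d - q ^ i) k, ← Finset.prod_mul_distrib,
      Nat.cast_prod]
    refine Finset.prod_congr rfl fun i hi => ?_
    have hi : i ≤ d := (Finset.mem_range.1 hi).le.trans hd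
    rw [Nat.cast_sub (Nat.pow_le_pow_right hq.le hi), mul_sub, ← pow_add,
      Nat.add_sub_cancel' hi]
    simp
  have h' : (Nat.card {P : Submodule 𝔽 V // finrank 𝔽 P = k} : ℚ) *
      ((∏ i : Fin k, (q ^ k - q ^ i.val) : ℕ) : ℚ) ≤
      ((∏ i : Fin k, (q ^ m - q ^ i.val) : ℕ) : ℚ) := by exact_mod_cast h
  rw [key k le_rfl, key m hk] at h'
  have hpos : 0 < ∏ i ∈ Finset.range k, (q : ℚ) ^ i :=
    Finset.prod_pos fun i _ => pow_pos (by linarith) _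
  have hpos' : 0 < ∏ i ∈ Finset.range k, ((q : ℚ) ^ (k - i) - 1) :=
    Finset.prod_pos fun i hi => sub_pos.2 (one_lt_pow₀ hq' (by
      have := Finset.mem_range.1 hi; omega))
  rw [gaussQ, Finset.prod_div_distrib, le_div_iff₀ hpos']
  rw [mul_left_comm] at h'
  exact le_of_mul_le_mul_left h' hpos

lemma ncard_le_and_finrank_eq_le_gaussQ (W : Submodule 𝔽 V) (k : ℕ) :
    ({L : Submodule 𝔽 V | L ≤ W ∧ finrank 𝔽 L = k}.ncard : ℚ) ≤
      gaussQ (Fintype.card 𝔽) (finrank 𝔽 W) k := by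
  refine le_trans ?_ (natCard_finrank_eq_le_gaussQ (V := W) k)
  have hsub : {L : Submodule 𝔽 V | L ≤ W ∧ finrank 𝔽 L = k} ⊆
      (Submodule.map W.subtype) '' {L : Submodule 𝔽 W | finrank 𝔽 L = k} := by
    rintro L ⟨hL, hk⟩
    have hmap : (L.comap W.subtype).map W.subtype = L := by
      rw [Submodule.map_comap_subtype, inf_eq_right.2 hL]
    refine ⟨L.comap W.subtype, ?_, hmap⟩
    rw [mem_ofPred_eq, ← Submodule.finrank_map_subtype_eq, hmap, hk]
  exact_mod_cast (ncard_le_ncard hsub (toFinite _)).trans (ncard_image_le (toFinite _))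

lemma ncard_ge_and_finrank_eq_le_gaussQ (P : Submodule 𝔽 V) {k : ℕ} (hk : finrank 𝔽 P ≤ k) :
    ({Q : Submodule 𝔽 V | P ≤ Q ∧ finrank 𝔽 Q = k}.ncard : ℚ) ≤
      gaussQ (Fintype.card 𝔽) (finrank 𝔽 V - finrank 𝔽 P) (k - finrank 𝔽 P) := by
  have hfin : Finite (V ⧸ P) := Quotient.finite _
  have h := natCard_finrank_eq_le_gaussQ (𝔽 := 𝔽) (V := V ⧸ P) (k - finrank 𝔽 P)
  have hquot := P.finrank_quotient_add_finrank
  rw [show finrank 𝔽 (V ⧸ P) = finrank 𝔽 V - finrank 𝔽 P by omega] at h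
  refine le_trans ?_ h
  have hsub : {Q : Submodule 𝔽 V | P ≤ Q ∧ finrank 𝔽 Q = k} ⊆
      (Submodule.comap P.mkQ) '' {L : Submodule 𝔽 (V ⧸ P) | finrank 𝔽 L = k - finrank 𝔽 P} := by
    rintro Q ⟨hPQ, hQ⟩
    refine ⟨Q.map P.mkQ, ?_, by rw [Submodule.comap_map_mkQ, sup_eq_right.2 hPQ]⟩
    have hrank := (P.mkQ.domRestrict Q).finrank_range_add_finrank_ker
    rw [LinearMap.range_domRestrict, LinearMap.ker_domRestrict, Submodule.ker_mkQ,
      (Submodule.comapSubtypeEquivOfLe hPQ).finrank_eq, hQ] at hrank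
    rw [mem_ofPred_eq]
    omega
  exact_mod_cast (ncard_le_ncard hsub (toFinite _)).trans (ncard_image_le (toFinite _))

omit [Fintype 𝔽] [Finite V] in
lemma exists_le_finrank_eq (C : Submodule 𝔽 V) {r : ℕ} (hr : r ≤ finrank 𝔽 C) :
    ∃ W ≤ C, finrank 𝔽 W = r := by
  obtain ⟨f, hf⟩ := exists_linearIndependent_of_le_finrank hr
  refine ⟨Submodule.span 𝔽 (range fun i => (f i : V)), ?_, ?_⟩
  · rw [Submodule.span_le]
    rintro _ ⟨i, rfl⟩
    exact (f i).2
  · exact (finrank_span_eq_card (hf.map' _ C.ker_subtype)).trans (Fintype.card_fin r)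

omit [Fintype 𝔽] in
/-- A subspace avoiding `P` that meets every subspace which meets `U` in dimension at least `d`. -/
lemma exists_transversal (P U : Submodule 𝔽 V) {d : ℕ} (hd : finrank 𝔽 ↥(P ⊓ U) < d) :
    ∃ W : Submodule 𝔽 V, P ⊓ W = ⊥ ∧ finrank 𝔽 W ≤ finrank 𝔽 U + 1 - d ∧
      ∀ Q : Submodule 𝔽 V, d ≤ finrank 𝔽 ↥(Q ⊓ U) → Q ⊓ W ≠ ⊥ := by
  obtain ⟨C, hdisj, hsup⟩ := IsModularLattice.exists_disjoint_and_sup_eq (inf_le_right : P ⊓ U ≤ U)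
  have hCU : C ≤ U := hsup ▸ le_sup_right
  have hC := Submodule.finrank_sup_add_finrank_inf_eq (P ⊓ U) C
  rw [hsup, hdisj.eq_bot, finrank_bot] at hC
  obtain ⟨W, hWC, hW⟩ := exists_le_finrank_eq C
    (show finrank 𝔽 U + 1 - d ≤ finrank 𝔽 C by omega)
  refine ⟨W, ?_, hW.le, fun Q hQ h => ?_⟩
  · refine (hdisj.mono_right hWC).eq_bot.symm ▸ le_antisymm ?_ ?_
    · exact le_inf (le_inf inf_le_left (inf_le_right.trans (hWC.trans hCU))) inf_le_right
    · exact inf_le_inf_right _ inf_le_left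
  · have hdim := Submodule.finrank_sup_add_finrank_inf_eq (Q ⊓ U) W
    have hbot : (Q ⊓ U) ⊓ W = ⊥ := le_bot_iff.1 (h ▸ inf_le_inf_right _ inf_le_left)
    have hle := Submodule.finrank_mono (sup_le inf_le_right (hWC.trans hCU) : (Q ⊓ U) ⊔ W ≤ U)
    rw [hbot, finrank_bot] at hdim
    omega

end SubspaceCounting

section Covers

variable {𝔽 : Type} [Field 𝔽] [Fintype 𝔽] {n : ℕ}

/-- If `x + P` does not meet the flat `B` in dimension `t`, then every larger coset `x + Q` doing so
has a direction in a fixed subspace `W` of dimension at most `k - t + 1`. -/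
lemma exists_transversal_coset {k t : ℕ} (htk : t ≤ k) (x : Fin n → 𝔽)
    (P : Submodule 𝔽 (Fin n → 𝔽)) {B : Set (Fin n → 𝔽)} (hB : IsFlat 𝔽 k B)
    (hPB : ¬ DimGe 𝔽 t (coset x P ∩ B)) :
    ∃ W : Submodule 𝔽 (Fin n → 𝔽), P ⊓ W = ⊥ ∧ finrank 𝔽 W ≤ k - t + 1 ∧
      ∀ Q, P ≤ Q → DimGe 𝔽 t (coset x Q ∩ B) → Q ⊓ W ≠ ⊥ := by
  rcases (coset x P ∩ B).eq_empty_or_nonempty with hempty | ⟨p, hpP, hpB⟩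
  · obtain ⟨b, R, hR, rfl⟩ := hB.exists_coset
    set U : Submodule 𝔽 (Fin n → 𝔽) := R ⊔ Submodule.span 𝔽 {b - x} with hU
    have hRU : R ≤ U := le_sup_left
    have hUdim : finrank 𝔽 U ≤ k + 1 := by
      refine (Submodule.finrank_add_le_finrank_add_finrank _ _).trans ?_
      rw [hR]
      exact Nat.add_le_add_left ((finrank_span_le_card {b - x}).trans_eq (by simp)) _
    obtain ⟨W, hPW, hW, hQW⟩ := exists_transversal P U
      (d := max t (finrank 𝔽 ↥(P ⊓ U)) + 1) (Nat.lt_succ_of_le (le_max_right _ _))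
    refine ⟨W, hPW, by omega, fun Q hPQ hQ => hQW Q (Nat.succ_le_of_lt (max_lt ?_ ?_))⟩
    all_goals
      obtain ⟨z, hzQ, hzB⟩ := hQ.nonempty
      have hzU : z - x ∈ U := by
        rw [show z - x = (z - b) + (b - x) by abel]
        exact U.add_mem (hRU hzB)
          (Submodule.mem_sup_right (Submodule.mem_span_singleton_self _))
      have hzQU : z - x ∈ Q ⊓ U := ⟨hzQ, hzU⟩
    · have hzR : z - x ∉ R := fun h => by
        have hxB : x ∈ coset b R := by
          rw [mem_coset, show x - b = (z - b) - (z - x) by abel]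
          exact R.sub_mem hzB h
        exact hempty.subset ⟨self_mem_coset x P, hxB⟩
      rw [coset_inter hzQ hzB, dimGe_coset_iff] at hQ
      exact hQ.trans_lt (Submodule.finrank_lt_finrank_of_lt
        (lt_of_le_of_ne (inf_le_inf_left _ hRU) fun h => hzR (h ▸ hzQU : z - x ∈ Q ⊓ R).2))
    · have hzP : z - x ∉ P := fun h => hempty.subset ⟨h, hzB⟩
      exact Submodule.finrank_lt_finrank_of_lt
        (lt_of_le_of_ne (inf_le_inf_right _ hPQ) fun h => hzP (h ▸ hzQU : z - x ∈ P ⊓ U).1)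
  · obtain ⟨R, hR, rfl⟩ := hB.exists_coset_of_mem hpB
    rw [coset_inter hpP hpB, dimGe_coset_iff, not_le] at hPB
    obtain ⟨W, hPW, hW, hQW⟩ := exists_transversal P R hPB
    refine ⟨W, hPW, by omega, fun Q hPQ hQ => hQW Q ?_⟩
    rwa [coset_inter (coset_mono hPQ hpP) hpB, dimGe_coset_iff] at hQ

omit [Fintype 𝔽] in
lemma tauT_le {t k : ℕ} {F : Set (Set (Fin n → 𝔽))} {T : Set (Fin n → 𝔽)} (hT : IsFlat 𝔽 k T)
    (hcover : IsTCover 𝔽 t T F) : tauT 𝔽 t F ≤ k := Nat.sInf_le ⟨T, hT, hcover⟩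

omit [Fintype 𝔽] in
lemma exists_isTCover_tauT {t k : ℕ} {F : Set (Set (Fin n → 𝔽))} {T : Set (Fin n → 𝔽)}
    (hT : IsFlat 𝔽 k T) (hcover : IsTCover 𝔽 t T F) :
    ∃ T, IsFlat 𝔽 (tauT 𝔽 t F) T ∧ IsTCover 𝔽 t T F :=
  Nat.sInf_mem (s := {x | ∃ T, IsFlat 𝔽 x T ∧ IsTCover 𝔽 t T F}) ⟨k, T, hT, hcover⟩

/-- The number of flats containing a given flat. -/
lemma ncard_coset_subset_le {k : ℕ} {F : Set (Set (Fin n → 𝔽))} (hF : ∀ A ∈ F, IsFlat 𝔽 k A)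
    (x : Fin n → 𝔽) (P : Submodule 𝔽 (Fin n → 𝔽)) (hPk : finrank 𝔽 P ≤ k) :
    ({A ∈ F | coset x P ⊆ A}.ncard : ℚ) ≤
      gaussQ (Fintype.card 𝔽) (n - finrank 𝔽 P) (k - finrank 𝔽 P) := by
  have h := ncard_ge_and_finrank_eq_le_gaussQ P hPk
  rw [finrank_fin_fun] at h
  refine le_trans ?_ h
  have hsub : {A ∈ F | coset x P ⊆ A} ⊆ coset x '' {Q | P ≤ Q ∧ finrank 𝔽 Q = k} := by
    rintro A ⟨hA, hPA⟩
    obtain ⟨Q, hQ, rfl⟩ := (hF A hA).exists_coset_of_mem (hPA (self_mem_coset x P))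
    exact ⟨Q, ⟨le_of_coset_subset hPA, hQ⟩, rfl⟩
  exact_mod_cast (ncard_le_ncard hsub (toFinite _)).trans (ncard_image_le (toFinite _))

lemma ncard_coset_subset_le_pow_mul {k₁ k₂ t : ℕ} (ht : t ≤ k₂) {F G : Set (Set (Fin n → 𝔽))}
    (hF : ∀ A ∈ F, IsFlat 𝔽 k₁ A) (hG : ∀ B ∈ G, IsFlat 𝔽 k₂ B) (hcross : CrossT 𝔽 t F G)
    (hτ : tauT 𝔽 t G ≤ k₁) (d : ℕ) (x : Fin n → 𝔽) (P : Submodule 𝔽 (Fin n → 𝔽))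
    (hd : finrank 𝔽 P + d = tauT 𝔽 t G) :
    ({A ∈ F | coset x P ⊆ A}.ncard : ℚ) ≤ gaussQ (Fintype.card 𝔽) (k₂ - t + 1) 1 ^ d *
      gaussQ (Fintype.card 𝔽) (n - tauT 𝔽 t G) (k₁ - tauT 𝔽 t G) := by
  have hq : 1 < Fintype.card 𝔽 := Fintype.one_lt_card
  induction d generalizing P with
  | zero =>
    rw [add_zero] at hd
    rw [pow_zero, one_mul, ← hd]
    exact ncard_coset_subset_le hF x P (hd ▸ hτ)
  | succ d ih =>
    set c := gaussQ (Fintype.card 𝔽) (k₂ - t + 1) 1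
    set N := gaussQ (Fintype.card 𝔽) (n - tauT 𝔽 t G) (k₁ - tauT 𝔽 t G)
    have hc : 0 ≤ c := gaussQ_nonneg hq.le _ _
    have hN : 0 ≤ N := gaussQ_nonneg hq.le _ _
    obtain ⟨B, hB, hPB⟩ : ∃ B ∈ G, ¬ DimGe 𝔽 t (coset x P ∩ B) := by
      by_contra! h
      have := tauT_le (isFlat_coset x rfl) h
      omega
    obtain ⟨W, hPW, hW, hQW⟩ := exists_transversal_coset ht x P (hG B hB) hPB
    let lines : Set (Submodule 𝔽 (Fin n → 𝔽)) := {L | L ≤ W ∧ finrank 𝔽 L = 1}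
    have hlines : (lines.ncard : ℚ) ≤ c :=
      (ncard_le_and_finrank_eq_le_gaussQ W 1).trans (gaussQ_one_mono hq hW)
    have hcover : {A ∈ F | coset x P ⊆ A} ⊆ ⋃ L ∈ lines.toFinite.toFinset,
        {A ∈ F | coset x (P ⊔ L) ⊆ A} := by
      rintro A ⟨hA, hPA⟩
      obtain ⟨Q, -, rfl⟩ := (hF A hA).exists_coset_of_mem (hPA (self_mem_coset x P))
      have hPQ := le_of_coset_subset hPA
      obtain ⟨w, hw, hw0⟩ := (Submodule.ne_bot_iff _).1 (hQW Q hPQ (hcross _ hA _ hB))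
      simp only [mem_iUnion, Finite.mem_toFinset]
      exact ⟨Submodule.span 𝔽 {w}, ⟨by simpa using hw.2, finrank_span_singleton hw0⟩, hA,
        coset_mono (sup_le hPQ (by simpa using hw.1))⟩
    have hstep (L) (hL : L ∈ lines.toFinite.toFinset) :
        ({A ∈ F | coset x (P ⊔ L) ⊆ A}.ncard : ℚ) ≤ c ^ d * N := by
      rw [Finite.mem_toFinset] at hL
      refine ih _ ?_
      have hdim := Submodule.finrank_sup_add_finrank_inf_eq P L
      rw [le_bot_iff.1 (hPW ▸ inf_le_inf_left P hL.1 : P ⊓ L ≤ ⊥), finrank_bot, hL.2] at hdim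
      omega
    calc ({A ∈ F | coset x P ⊆ A}.ncard : ℚ)
        ≤ ∑ L ∈ lines.toFinite.toFinset, ({A ∈ F | coset x (P ⊔ L) ⊆ A}.ncard : ℚ) := by
          exact_mod_cast (ncard_le_ncard hcover (toFinite _)).trans
            (Finset.set_ncard_biUnion_le _ _)
      _ ≤ lines.ncard * (c ^ d * N) := by
          refine (Finset.sum_le_card_nsmul _ _ _ hstep).trans_eq ?_
          rw [nsmul_eq_mul, ← ncard_eq_toFinset_card lines]
      _ ≤ c * (c ^ d * N) := by gcongr
      _ = c ^ (d + 1) * N := by ring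

/-- Counting the `t`-flats of a `t`-cover below the members of the family. -/
lemma ncard_mul_pow_le {t τ : ℕ} {F : Set (Set (Fin n → 𝔽))} {T : Set (Fin n → 𝔽)}
    (hF : ∀ A ∈ F, ∃ k, IsFlat 𝔽 k A) (hT : IsFlat 𝔽 τ T) (hcover : IsTCover 𝔽 t T F) {N : ℚ}
    (hN0 : 0 ≤ N) (hN : ∀ (x : Fin n → 𝔽) (P : Submodule 𝔽 (Fin n → 𝔽)), finrank 𝔽 P = t →
      ({A ∈ F | coset x P ⊆ A}.ncard : ℚ) ≤ N) :
    (F.ncard : ℚ) * (Fintype.card 𝔽 : ℚ) ^ t ≤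
      (Fintype.card 𝔽 : ℚ) ^ τ * gaussQ (Fintype.card 𝔽) τ t * N := by
  classical
  obtain ⟨y, R, hR, rfl⟩ := hT.exists_coset
  let dirs : Set (Submodule 𝔽 (Fin n → 𝔽)) := {P | P ≤ R ∧ finrank 𝔽 P = t}
  have hdirs : (dirs.ncard : ℚ) ≤ gaussQ (Fintype.card 𝔽) τ t :=
    hR ▸ ncard_le_and_finrank_eq_le_gaussQ R t
  have hpoints (x : Fin n → 𝔽) (P : Submodule 𝔽 (Fin n → 𝔽)) :
      (coset x P).ncard = Fintype.card 𝔽 ^ finrank 𝔽 P := by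
    have : coset x P = (fun v => v + x) '' (P : Set (Fin n → 𝔽)) := by
      ext v
      simp [mem_coset, sub_eq_add_neg]
    rw [this, ncard_image_of_injective _ (add_left_injective x), ← Nat.card_coe_set_eq,
      ← Nat.card_eq_fintype_card]
    exact Module.natCard_eq_pow_finrank
  have hcount := Finset.card_mul_le_card_mul (s := F.toFinite.toFinset)
    (t := (coset y R ×ˢ dirs).toFinite.toFinset)
    (fun A p => coset p.1 p.2 ⊆ A) (m := Fintype.card 𝔽 ^ t) (n := ⌊N⌋₊) ?_ ?_
  · rw [← ncard_eq_toFinset_card, ← ncard_eq_toFinset_card, ncard_prod, hpoints, hR] at hcount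
    calc (F.ncard : ℚ) * (Fintype.card 𝔽 : ℚ) ^ t
        ≤ (Fintype.card 𝔽 : ℚ) ^ τ * dirs.ncard * ⌊N⌋₊ := by exact_mod_cast hcount
      _ ≤ _ := by
        gcongr
        · exact mul_nonneg (by positivity) ((Nat.cast_nonneg _).trans hdirs)
        · exact Nat.floor_le hN0
  · intro A hA
    rw [Finite.mem_toFinset] at hA
    obtain ⟨k, hk⟩ := hF A hA
    obtain ⟨z, hzT, hzA⟩ := (hcover A hA).nonempty
    obtain ⟨Q, -, rfl⟩ := hk.exists_coset_of_mem hzA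
    have hdim := hcover _ hA
    rw [coset_inter hzT hzA, dimGe_coset_iff] at hdim
    obtain ⟨P, hP, hPt⟩ := exists_le_finrank_eq _ hdim
    rw [← hPt, ← hpoints z P, ncard_eq_toFinset_card, ← Finset.card_image_of_injective _
      (Prod.mk_left_injective P)]
    refine Finset.card_le_card fun p hp => ?_
    obtain ⟨v, hv, rfl⟩ := Finset.mem_image.1 hp
    rw [Finite.mem_toFinset] at hv
    rw [Finset.mem_bipartiteAbove, Finite.mem_toFinset]
    refine ⟨⟨?_, hP.trans inf_le_left, hPt⟩, ?_⟩
    · rw [coset_eq_of_mem hzT]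
      exact coset_mono (hP.trans inf_le_left) hv
    · rw [← coset_eq_of_mem hv]
      exact coset_mono (hP.trans inf_le_right)
  · rintro ⟨x, P⟩ hp
    rw [Finite.mem_toFinset] at hp
    refine Nat.le_floor (le_trans ?_ (hN x P hp.2.2))
    rw [ncard_eq_toFinset_card]
    refine Nat.cast_le.2 (Finset.card_le_card fun A hA => ?_)
    simpa [Finset.mem_bipartiteBelow] using hA

omit [Fintype 𝔽] in
lemma le_tauT {t k : ℕ} {F : Set (Set (Fin n → 𝔽))} {T : Set (Fin n → 𝔽)} (hF : F.Nonempty)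
    (hT : IsFlat 𝔽 k T) (hcover : IsTCover 𝔽 t T F) : t ≤ tauT 𝔽 t F := by
  obtain ⟨A, hA⟩ := hF
  obtain ⟨S, hS, hSF⟩ := exists_isTCover_tauT hT hcover
  obtain ⟨j, hj, hflat⟩ := hSF A hA
  obtain ⟨z, P, hP, hSA⟩ := hflat.exists_coset
  have hz : z ∈ S ∩ A := hSA ▸ self_mem_coset z P
  obtain ⟨R, hR, rfl⟩ := hS.exists_coset_of_mem hz.1
  rw [← hR]
  exact hj.trans (hP ▸ Submodule.finrank_mono (le_of_coset_subset (hSA ▸ inter_subset_left)))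

end Covers

theorem stmt_11 (q : ℕ) (hq : IsPrimePow q)
    (𝔽 : Type) [Field 𝔽] [Fintype 𝔽] (hcard : Fintype.card 𝔽 = q)
    (n k1 k2 t : ℕ) (ht : 0 < t) (hk1 : t ≤ k1) (hk2 : t ≤ k2)
    (hn : k1 + k2 - t + 1 ≤ n)
    (F G : Set (Set (Fin n → 𝔽))) (hFne : F.Nonempty) (hGne : G.Nonempty)
    (hF : ∀ A ∈ F, IsFlat 𝔽 k1 A) (hG : ∀ B ∈ G, IsFlat 𝔽 k2 B)
    (hcross : CrossT 𝔽 t F G) :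
    (F.ncard : ℚ) ≤ (q : ℚ) ^ (tauT 𝔽 t F - t) * gaussQ q (tauT 𝔽 t F) t
      * gaussQ q (k2 - t + 1) 1 ^ (tauT 𝔽 t G - t)
      * gaussQ q (n - tauT 𝔽 t G) (k1 - tauT 𝔽 t G) := by
  subst hcard
  obtain ⟨A, hA⟩ := hFne
  obtain ⟨B, hB⟩ := hGne
  have hBF : IsTCover 𝔽 t B F := fun A' hA' => inter_comm B A' ▸ hcross A' hA' B hB
  have hAG : IsTCover 𝔽 t A G := hcross A hA
  obtain ⟨T, hT, hTF⟩ := exists_isTCover_tauT (hG B hB) hBF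
  have htF := le_tauT ⟨A, hA⟩ (hG B hB) hBF
  have htG := le_tauT ⟨B, hB⟩ (hF A hA) hAG
  have hq : 1 < Fintype.card 𝔽 := Fintype.one_lt_card
  have hpos : (0 : ℚ) < (Fintype.card 𝔽 : ℚ) ^ t := by positivity
  have hcount := ncard_mul_pow_le (fun A hA => ⟨k1, hF A hA⟩) hT hTF
    (mul_nonneg (pow_nonneg (gaussQ_nonneg hq.le _ _) _) (gaussQ_nonneg hq.le _ _))
    fun x P hP => ncard_coset_subset_le_pow_mul hk2 hF hG hcross (tauT_le (hF A hA) hAG)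
      (tauT 𝔽 t G - t) x P (by omega)
  refine le_of_mul_le_mul_right (hcount.trans_eq ?_) hpos
  rw [← pow_sub_mul_pow (Fintype.card 𝔽 : ℚ) htF]
  ring
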